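/- For any finite non-degenerate network (V,K) with n := |V|, any λ ∈ (0,∞) and any admissible ν, the separation mixing time of the ARW(K,λ,ν) chain satisfies t_sep ≤ ( √𝓡 + 3√(t_rel · log n) )², where 𝓡 := n · max_{x∈V} P_𝒰(τ_x<τ_†)/p(x), 𝒰 is the uniform law on V, p(x) := P_ν(τ_x < τ_†), and t_rel = (min_{x∈V} p(x))^{-1}. -/

import Mathlib

open scoped ENNReal BigOperators
open Filter Asymptotics

namespace ARW

variable {V : Type} [Fintype V] [DecidableEq V]

/-- A sub-stochastic matrix: every row sums to at most `1`. -/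
def SubStochastic (K : V → V → ℝ≥0∞) : Prop := ∀ x, ∑ y, K x y ≤ 1

/-- Non-degenerate: no principal sub-matrix of `K` is stochastic. -/
def NonDegenerate (K : V → V → ℝ≥0∞) : Prop :=
  ∀ S : Finset V, S.Nonempty → ∃ x ∈ S, ∑ y ∈ S, K x y ≠ 1

/-- A probability vector on `V`. -/
def IsProbVec (ν : V → ℝ≥0∞) : Prop := ∑ x, ν x = 1

/-- Probability that the `K`-walk currently at `x` next follows the trajectory `xs`
and is then killed. -/
noncomputable def pathProb (K : V → V → ℝ≥0∞) : V → List V → ℝ≥0∞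
  | x, [] => 1 - ∑ y, K x y
  | x, y :: ys => K x y * pathProb K y ys

/-- Probability that a `(K,ν)`-walk has the (finite) full trajectory `w`. -/
noncomputable def walkProb (K : V → V → ℝ≥0∞) (ν : V → ℝ≥0∞) : List V → ℝ≥0∞
  | [] => 0
  | x :: xs => ν x * pathProb K x xs

/-- `p(x)`: the probability that a `(K,ν)`-walk visits `x` before dying. -/
noncomputable def hitProb (K : V → V → ℝ≥0∞) (ν : V → ℝ≥0∞) (x : V) : ℝ≥0∞ :=
  ∑' w : List V, if x ∈ w then walkProb K ν w else 0

/-- The insertion law `ν` is admissible when every site has a chance of being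
visited by a `(K,ν)`-walk. -/
def Admissible (K : V → V → ℝ≥0∞) (ν : V → ℝ≥0∞) : Prop := ∀ x, 0 < hitProb K ν x

/-- The uniform law on `V`. -/
noncomputable def unifLaw (V : Type) [Fintype V] : V → ℝ≥0∞ :=
  fun _ => (Fintype.card V : ℝ≥0∞)⁻¹

/-! ### IDLA -/

/-- The IDLA update: the walker settles at the first site of its trajectory
which is not already occupied. -/
def idlaUpdate (S : Finset V) : List V → Finset V
  | [] => S
  | x :: xs => if x ∈ S then idlaUpdate S xs else insert x S

/-- The IDLA aggregate obtained from the initial set `A` after using the walks `ws`. -/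
def idlaSet (A : Finset V) (ws : List (List V)) : Finset V := ws.foldl idlaUpdate A

/-- `P(T^A > t)`: probability that the IDLA process started from `A` and driven by
i.i.d. `(K,ν)`-walks has not filled `V` after `t` steps. -/
noncomputable def idlaTail (K : V → V → ℝ≥0∞) (ν : V → ℝ≥0∞) (A : Finset V) (t : ℕ) : ℝ≥0∞ :=
  ∑' ws : Fin t → List V,
    (∏ i, walkProb K ν (ws i)) * (if idlaSet A (List.ofFn ws) = Finset.univ then 0 else 1)

/-- `E[T^A]`: the expected filling time of IDLA started from `A`. -/
noncomputable def idlaMean (K : V → V → ℝ≥0∞) (ν : V → ℝ≥0∞) (A : Finset V) : ℝ≥0∞ :=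
  ∑' t : ℕ, idlaTail K ν A t

/-- `Var(T^A)`: the variance of the filling time of IDLA started from `A`. -/
noncomputable def idlaVar (K : V → V → ℝ≥0∞) (ν : V → ℝ≥0∞) (A : Finset V) : ℝ≥0∞ :=
  (∑' t : ℕ, (2 * t + 1) * idlaTail K ν A t) - (idlaMean K ν A) ^ 2

/-! ### The ARW chain -/

/-- The state of a single site: empty, one sleeping particle, or `n+1` active particles. -/
inductive Site : Type
  | empty : Site
  | sleeping : Site
  | active (n : ℕ) : Site
deriving DecidableEq

/-- A configuration of particles. -/
abbrev Conf (V : Type) := V → Site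

def Site.isActive : Site → Bool
  | .active _ => true
  | _ => false

/-- The set of sites holding at least one active particle. -/
def activeSites (η : Conf V) : Finset V := Finset.univ.filter fun x => (η x).isActive

/-- Adding one active particle to a site (waking a sleeping particle if present). -/
def Site.addActive : Site → Site
  | .empty => .active 0
  | .sleeping => .active 1
  | .active n => .active (n + 1)

/-- Removing one active particle from a site. -/
def Site.removeOne : Site → Site
  | .active (n + 1) => .active n
  | _ => .empty

/-- Adding one active particle at site `y`. -/
def addActiveAt (η : Conf V) (y : V) : Conf V := Function.update η y (η y).addActive

/-- One sequential toppling step of ARW stabilization with sleep rate `lam`: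
an active site `x` is selected (if any); if its particle is alone it falls asleep
with probability `lam/(1+lam)`, moves to `y` with probability `K x y/(1+lam)` and
dies with the remaining probability; if it is not alone it moves to `y` with
probability `K x y` and dies with the remaining probability.  Stable
configurations are absorbing. -/
noncomputable def toppleKernel (K : V → V → ℝ≥0∞) (lam : ℝ) (η ξ : Conf V) : ℝ≥0∞ :=
  if h : (activeSites η).Nonempty then
    let x := h.choose
    let ημ : Conf V := Function.update η x (η x).removeOne
    let move : ℝ≥0∞ := ∑ y, if ξ = addActiveAt ημ y then K x y else 0
    let die : ℝ≥0∞ := if ξ = ημ then 1 - ∑ y, K x y else 0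
    if η x = Site.active 0 then
      ((if ξ = Function.update η x Site.sleeping then ENNReal.ofReal lam else 0) + move + die)
        / (ENNReal.ofReal lam + 1)
    else move + die
  else if ξ = η then 1 else 0

/-- Iterates of a sub-probability kernel on configurations. -/
noncomputable def kernelPow (M : Conf V → Conf V → ℝ≥0∞) : ℕ → Conf V → Conf V → ℝ≥0∞
  | 0 => fun η ξ => if ξ = η then 1 else 0
  | t + 1 => fun η ξ => ∑' σ : Conf V, M η σ * kernelPow M t σ ξ

/-- A stable configuration, seen as a configuration (`true` = sleeping particle). -/
def embed (b : V → Bool) : Conf V := fun x => if b x then Site.sleeping else Site.empty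

/-- One step of the `ARW(K,lam,ν)` chain: insert an active particle at a `ν`-distributed
site and stabilize; `arwStep K lam ν η ξ` is the probability of reaching the stable
configuration `ξ` from the stable configuration `η`. -/
noncomputable def arwStep (K : V → V → ℝ≥0∞) (lam : ℝ) (ν : V → ℝ≥0∞)
    (η ξ : V → Bool) : ℝ≥0∞ :=
  ∑ x, ν x * ⨆ t, kernelPow (toppleKernel K lam) t (addActiveAt (embed η) x) (embed ξ)

/-- The transition matrix of the `ARW(K,lam,ν)` chain on stable configurations. -/
noncomputable def arwMatrix (K : V → V → ℝ≥0∞) (lam : ℝ) (ν : V → ℝ≥0∞) :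
    Matrix (V → Bool) (V → Bool) ℝ :=
  Matrix.of fun η ξ => (arwStep K lam ν η ξ).toReal

/-! ### Distances to equilibrium, mixing and relaxation times -/

variable {S : Type} [Fintype S] [DecidableEq S]

/-- `π` is a stationary probability distribution for `P`. -/
def IsStationary (P : Matrix S S ℝ) (π : S → ℝ) : Prop :=
  (∀ s, 0 ≤ π s) ∧ (∑ s, π s = 1) ∧ ∀ s, ∑ r, π r * P r s = π s

/-- The separation distance to equilibrium at time `t`. -/
noncomputable def sepDist (P : Matrix S S ℝ) (π : S → ℝ) (t : ℕ) : ℝ :=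
  ⨆ η, ⨆ ξ, (1 - (P ^ t) η ξ / π ξ)

/-- The separation mixing time with precision `ε`. -/
noncomputable def sepMix (P : Matrix S S ℝ) (π : S → ℝ) (ε : ℝ) : ℕ :=
  sInf {t : ℕ | sepDist P π t ≤ ε}

/-- The total-variation distance to equilibrium at time `t`. -/
noncomputable def tvDist (P : Matrix S S ℝ) (π : S → ℝ) (t : ℕ) : ℝ :=
  ⨆ η, ⨆ A : Finset S, |∑ ξ ∈ A, ((P ^ t) η ξ - π ξ)|

/-- The total-variation mixing time with precision `ε`. -/
noncomputable def tvMix (P : Matrix S S ℝ) (π : S → ℝ) (ε : ℝ) : ℕ :=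
  sInf {t : ℕ | tvDist P π t ≤ ε}

/-- The relaxation time `1/(1-ρ)`, where `ρ` is the largest modulus of the
(complex) eigenvalues of `P` other than `1`. -/
noncomputable def relTime (P : Matrix S S ℝ) : ℝ :=
  (1 - sSup {r : ℝ | ∃ z : ℂ,
      z ≠ 1 ∧ (P.map (fun a : ℝ => (a : ℂ))).charpoly.IsRoot z ∧ r = ‖z‖})⁻¹

/-- Separation (or total-variation) cutoff for a sequence of chains with distance
functions `d n` and mixing times `ts n`. -/
def HasCutoff (d : ℕ → ℕ → ℝ) (ts : ℕ → ℕ) : Prop :=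
  ∀ α : ℝ, 0 ≤ α →
    (α < 1 → Tendsto (fun n => d n ⌊α * (ts n : ℝ)⌋₊) atTop (nhds 1)) ∧
    (1 < α → Tendsto (fun n => d n ⌊α * (ts n : ℝ)⌋₊) atTop (nhds 0))

end ARW

namespace ARW

/-! ### Lazy toppling and the abelian property -/

section abelian

set_option linter.unusedSectionVars false

variable {V : Type} [Fintype V] [DecidableEq V]

def Site.slp : Site → Site
  | .active 0 => .sleeping
  | s => s

/-- apply a local map at one site -/
def loc (x : V) (g : Site → Site) (σ : Conf V) : Conf V := Function.update σ x (g (σ x))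

theorem loc_comm {x z : V} (h : x ≠ z) (g g' : Site → Site) (σ : Conf V) :
    loc x g (loc z g' σ) = loc z g' (loc x g σ) := by
  unfold loc
  rw [Function.update_of_ne h, Function.update_of_ne h.symm, Function.update_comm h]

theorem loc_loc (x : V) (g g' : Site → Site) (σ : Conf V) :
    loc x g (loc x g' σ) = Function.update σ x (g (g' (σ x))) := by
  unfold loc
  simp

theorem addActiveAt_eq (σ : Conf V) (y : V) : addActiveAt σ y = loc y Site.addActive σ := rfl

/-- instructions: sleep / die / move -/
abbrev Instr (V : Type) := Option (Option V)

def act (x : V) : Instr V → Conf V → Conf V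
  | none, σ => loc x Site.slp σ
  | some none, σ => loc x Site.removeOne σ
  | some (some y), σ => addActiveAt (loc x Site.removeOne σ) y

theorem add_comm' (σ : Conf V) (y z : V) :
    addActiveAt (addActiveAt σ y) z = addActiveAt (addActiveAt σ z) y := by
  simp only [addActiveAt_eq]
  by_cases h : z = y
  · subst h; rfl
  · exact loc_comm h _ _ _

theorem slp_add {s : Site} (h : s.isActive = true) : s.addActive.slp = s.slp.addActive := by
  cases s with
  | empty => cases h
  | sleeping => cases h
  | active n => cases n <;> rfl

theorem rem_add {s : Site} (h : s.isActive = true) :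
    s.addActive.removeOne = s.removeOne.addActive := by
  cases s with
  | empty => cases h
  | sleeping => cases h
  | active n => cases n <;> rfl

theorem loc_slp_add {σ : Conf V} {x : V} (h : (σ x).isActive = true) (y : V) :
    loc x Site.slp (addActiveAt σ y) = addActiveAt (loc x Site.slp σ) y := by
  simp only [addActiveAt_eq]
  by_cases e : x = y
  · subst e; rw [loc_loc, loc_loc, slp_add h]
  · exact loc_comm e _ _ _

theorem loc_rem_add {σ : Conf V} {x : V} (h : (σ x).isActive = true) (y : V) :
    loc x Site.removeOne (addActiveAt σ y) = addActiveAt (loc x Site.removeOne σ) y := by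
  simp only [addActiveAt_eq]
  by_cases e : x = y
  · subst e; rw [loc_loc, loc_loc, rem_add h]
  · exact loc_comm e _ _ _

theorem act_add {σ : Conf V} {x : V} (h : (σ x).isActive = true) (y : V) (i : Instr V) :
    act x i (addActiveAt σ y) = addActiveAt (act x i σ) y := by
  match i with
  | none => exact loc_slp_add h y
  | some none => exact loc_rem_add h y
  | some (some z) =>
    simp only [act]
    rw [loc_rem_add h, add_comm']

theorem addActive_isActive (s : Site) : s.addActive.isActive = true := by cases s <;> rfl

theorem isActive_add {σ : Conf V} {x : V} (h : (σ x).isActive = true) (y : V) :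
    ((addActiveAt σ y) x).isActive = true := by
  unfold addActiveAt
  by_cases e : x = y
  · subst e; simp [addActive_isActive]
  · simpa [Function.update_of_ne e] using h

theorem isActive_loc {σ : Conf V} {x z : V} (h : (σ x).isActive = true) (e : x ≠ z)
    (g : Site → Site) : ((loc z g σ) x).isActive = true := by
  unfold loc; simpa [Function.update_of_ne e] using h

theorem isActive_act {σ : Conf V} {x z : V} (h : (σ x).isActive = true) (e : x ≠ z)
    (i : Instr V) : ((act z i σ) x).isActive = true := by
  match i with
  | none => exact isActive_loc h e _
  | some none => exact isActive_loc h e _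
  | some (some y) => exact isActive_add (isActive_loc h e _) y

theorem act_comm {σ : Conf V} {x z : V} (hx : (σ x).isActive = true) (hz : (σ z).isActive = true)
    (e : x ≠ z) (i j : Instr V) : act x i (act z j σ) = act z j (act x i σ) := by
  have key : ∀ (g : Site → Site), (∀ τ : Conf V, (τ z).isActive = true → ∀ y,
      loc z g (addActiveAt τ y) = addActiveAt (loc z g τ) y) →
      act x i (loc z g σ) = loc z g (act x i σ) := by
    intro g hg
    match i with
    | none => exact loc_comm e _ _ _
    | some none => exact loc_comm e _ _ _
    | some (some y) =>
      simp only [act]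
      rw [loc_comm e, hg _ (isActive_loc hz e.symm _)]
  match j with
  | none => exact key _ fun τ h y => loc_slp_add h y
  | some none => exact key _ fun τ h y => loc_rem_add h y
  | some (some y) =>
    change act x i (addActiveAt (loc z Site.removeOne σ) y)
      = addActiveAt (loc z Site.removeOne (act x i σ)) y
    rw [act_add (isActive_loc hx e _), key _ fun τ h y => loc_rem_add h y]

/-- weights of instructions -/
noncomputable def wt (K : V → V → ℝ≥0∞) (l : ℝ≥0∞) (x : V) : Instr V → ℝ≥0∞
  | none => l / (l + 1)
  | some none => (1 - ∑ y, K x y) / (l + 1)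
  | some (some y) => K x y / (l + 1)

/-- lazy toppling operator -/
noncomputable def Top (K : V → V → ℝ≥0∞) (l : ℝ≥0∞) (x : V) (f : Conf V → ℝ≥0∞) (σ : Conf V) :
    ℝ≥0∞ := ∑ i, wt K l x i * f (act x i σ)

variable {K : V → V → ℝ≥0∞} {l : ℝ≥0∞}

theorem Top_mono (x : V) {f g : Conf V → ℝ≥0∞} {σ : Conf V}
    (h : ∀ i, f (act x i σ) ≤ g (act x i σ)) : Top K l x f σ ≤ Top K l x g σ := by
  unfold Top; gcongr with i; exact h i

theorem Top_congr (x : V) {f g : Conf V → ℝ≥0∞} {σ : Conf V}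
    (h : ∀ i, f (act x i σ) = g (act x i σ)) : Top K l x f σ = Top K l x g σ := by
  unfold Top; simp only [h]

theorem Top_comm {σ : Conf V} {x z : V} (hx : (σ x).isActive = true) (hz : (σ z).isActive = true)
    (e : x ≠ z) (f : Conf V → ℝ≥0∞) :
    Top K l x (Top K l z f) σ = Top K l z (Top K l x f) σ := by
  unfold Top
  simp only [Finset.mul_sum]
  rw [Finset.sum_comm]
  refine Finset.sum_congr rfl fun i _ => Finset.sum_congr rfl fun j _ => ?_
  rw [act_comm hx hz e]; ring

theorem wt_sum (hsub : SubStochastic K) (hl : l ≠ ⊤) (x : V) : ∑ i, wt K l x i = 1 := by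
  rw [Fintype.sum_option, Fintype.sum_option]
  simp only [wt, div_eq_mul_inv]
  rw [← Finset.sum_mul, ← add_mul, ← add_mul, tsub_add_cancel_of_le (hsub x)]
  exact ENNReal.mul_inv_cancel (by simp) (by simp [hl])

theorem mem_activeSites {σ : Conf V} {x : V} : x ∈ activeSites σ ↔ (σ x).isActive = true := by
  simp [activeSites]

theorem embed_not_active (b : V → Bool) : ¬ (activeSites (embed b)).Nonempty := by
  rintro ⟨x, hx⟩
  rw [mem_activeSites] at hx
  unfold embed at hx
  split_ifs at hx <;> cases hx

theorem stable_embed {σ : Conf V} (h : ¬ (activeSites σ).Nonempty) : ∃ b, σ = embed b := by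
  refine ⟨fun x => decide (σ x = Site.sleeping), ?_⟩
  funext x
  have hx : ¬ (σ x).isActive = true := fun hx => h ⟨x, mem_activeSites.2 hx⟩
  unfold embed
  cases hs : σ x with
  | empty => simp [hs]
  | sleeping => simp [hs]
  | active n => rw [hs] at hx; exact absurd rfl hx

theorem embed_inj {b c : V → Bool} (h : (embed b : Conf V) = embed c) : b = c := by
  funext x
  have := congrFun h x
  unfold embed at this
  cases hb : b x <;> cases hc : c x <;> simp [hb, hc] at this ⊢

/-- probability of stabilizing to `ξ` in at most `k` lazy topplings -/
noncomputable def FL (K : V → V → ℝ≥0∞) (l : ℝ≥0∞) (ξ : V → Bool) : ℕ → Conf V → ℝ≥0∞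
  | 0 => fun σ => if σ = embed ξ then 1 else 0
  | k + 1 => fun σ => if h : (activeSites σ).Nonempty then Top K l h.choose (FL K l ξ k) σ
      else if σ = embed ξ then 1 else 0

theorem FL_stable (ξ : V → Bool) (k : ℕ) {σ : Conf V} (h : ¬ (activeSites σ).Nonempty) :
    FL K l ξ k σ = if σ = embed ξ then 1 else 0 := by
  cases k with
  | zero => rfl
  | succ k => simp [FL, h]

theorem FL_succ (ξ : V → Bool) (k : ℕ) {σ : Conf V} (h : (activeSites σ).Nonempty) :
    FL K l ξ (k + 1) σ = Top K l h.choose (FL K l ξ k) σ := dif_pos h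

theorem FL_zero_active (ξ : V → Bool) {σ : Conf V} {x : V} (h : (σ x).isActive = true) :
    FL K l ξ 0 σ = 0 := by
  simp only [FL]
  rw [if_neg]
  rintro rfl
  exact embed_not_active ξ ⟨x, mem_activeSites.2 h⟩

theorem FL_abelian (ξ : V → Bool) (k : ℕ) : ∀ {σ : Conf V} {x : V}, (σ x).isActive = true →
    FL K l ξ (k + 1) σ = Top K l x (FL K l ξ k) σ := by
  induction k with
  | zero =>
    intro σ x hx
    have h : (activeSites σ).Nonempty := ⟨x, mem_activeSites.2 hx⟩
    have hz := mem_activeSites.1 h.choose_spec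
    rw [FL_succ ξ _ h]
    by_cases e : h.choose = x
    · rw [e]
    · have a1 : Top K l h.choose (FL K l ξ 0) σ = 0 := by
        unfold Top
        refine Finset.sum_eq_zero fun i _ => ?_
        rw [FL_zero_active ξ (isActive_act hx (Ne.symm e) i), mul_zero]
      have a2 : Top K l x (FL K l ξ 0) σ = 0 := by
        unfold Top
        refine Finset.sum_eq_zero fun i _ => ?_
        rw [FL_zero_active ξ (isActive_act hz e i), mul_zero]
      rw [a1, a2]
  | succ k ih =>
    intro σ x hx
    have h : (activeSites σ).Nonempty := ⟨x, mem_activeSites.2 hx⟩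
    have hz := mem_activeSites.1 h.choose_spec
    rw [FL_succ ξ _ h]
    by_cases e : h.choose = x
    · rw [e]
    · rw [Top_congr h.choose (g := Top K l x (FL K l ξ k))
        fun i => ih (isActive_act hx (Ne.symm e) i), Top_comm hz hx e]
      exact Top_congr x fun i => (ih (isActive_act hz e i)).symm

theorem FL_mono (ξ : V → Bool) : Monotone (FL K l ξ) := by
  refine monotone_nat_of_le_succ fun k => ?_
  induction k with
  | zero =>
    intro σ
    by_cases h : (activeSites σ).Nonempty
    · obtain ⟨x, hx⟩ := h
      rw [FL_zero_active ξ (mem_activeSites.1 hx)]; exact zero_le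
    · rw [FL_stable ξ _ h, FL_stable ξ _ h]
  | succ k ih =>
    intro σ
    by_cases h : (activeSites σ).Nonempty
    · obtain ⟨x, hx⟩ := h
      rw [FL_abelian ξ _ (mem_activeSites.1 hx), FL_abelian ξ _ (mem_activeSites.1 hx)]
      exact Top_mono x fun i => ih _
    · rw [FL_stable ξ _ h, FL_stable ξ _ h]

/-- stabilization law -/
noncomputable def St (K : V → V → ℝ≥0∞) (l : ℝ≥0∞) (ξ : V → Bool) (σ : Conf V) : ℝ≥0∞ :=
  ⨆ k, FL K l ξ k σ

theorem Top_iSup (x : V) (f : ℕ → Conf V → ℝ≥0∞) (hf : Monotone f) (σ : Conf V) :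
    Top K l x (fun τ => ⨆ k, f k τ) σ = ⨆ k, Top K l x (f k) σ := by
  unfold Top
  simp only [ENNReal.mul_iSup]
  rw [ENNReal.finsetSum_iSup_of_monotone]
  intro i a b hab
  exact mul_le_mul_right (hf hab _) _

theorem St_harm (ξ : V → Bool) {σ : Conf V} {x : V} (h : (σ x).isActive = true) :
    Top K l x (St K l ξ) σ = St K l ξ σ := by
  unfold St
  rw [Top_iSup x _ (FL_mono ξ)]
  apply le_antisymm
  · refine iSup_le fun k => ?_
    rw [← FL_abelian ξ k h]
    exact le_iSup (fun k => FL K l ξ k σ) (k+1)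
  · refine iSup_le fun k => ?_
    refine le_trans (FL_mono ξ (Nat.le_succ k) σ) ?_
    rw [Nat.succ_eq_add_one, FL_abelian ξ k h]
    exact le_iSup (fun k => Top K l x (FL K l ξ k) σ) k

theorem St_embed (ξ η : V → Bool) : St K l ξ (embed η) = if η = ξ then 1 else 0 := by
  unfold St
  simp only [FL_stable ξ _ (embed_not_active η), ciSup_const]
  by_cases h : η = ξ
  · simp [h]
  · rw [if_neg h, if_neg fun e => h (embed_inj e)]

theorem St_minimal (ξ : V → Bool) (G : Conf V → ℝ≥0∞)
    (h0 : 1 ≤ G (embed ξ))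
    (h1 : ∀ σ (h : (activeSites σ).Nonempty), Top K l h.choose G σ ≤ G σ) (σ : Conf V) :
    St K l ξ σ ≤ G σ := by
  refine iSup_le fun k => ?_
  induction k generalizing σ with
  | zero =>
    simp only [FL]
    split_ifs with h
    · rw [h]; exact h0
    · exact zero_le
  | succ k ih =>
    by_cases h : (activeSites σ).Nonempty
    · rw [FL_succ ξ k h]
      exact (Top_mono _ fun i => ih _).trans (h1 σ h)
    · rw [FL_stable ξ _ h]
      split_ifs with h'
      · rw [h']; exact h0
      · exact zero_le

theorem St_le_one (hsub : SubStochastic K) (hl : l ≠ ⊤) (ξ : V → Bool) (σ : Conf V) :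
    St K l ξ σ ≤ 1 := by
  refine St_minimal ξ (fun _ => 1) le_rfl (fun σ h => ?_) σ
  unfold Top
  simp [wt_sum hsub hl]

/-- adding a particle commutes with stabilization -/
theorem St_add (ξ : V → Bool) (y : V) (σ : Conf V) :
    St K l ξ (addActiveAt σ y)
      = ∑ η, St K l η σ * St K l ξ (addActiveAt (embed η) y) := by
  set H : Conf V → ℝ≥0∞ := fun σ => ∑ η, St K l η σ * St K l ξ (addActiveAt (embed η) y) with hH
  have Hharm : ∀ {σ : Conf V} {x : V}, (σ x).isActive = true → Top K l x H σ = H σ := by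
    intro σ x hx
    simp only [hH, Top, Finset.mul_sum]
    rw [Finset.sum_comm]
    refine Finset.sum_congr rfl fun η _ => ?_
    rw [← St_harm η hx, Top, Finset.sum_mul]
    refine Finset.sum_congr rfl fun i _ => by ring
  have Hst : ∀ b, H (embed b) = St K l ξ (addActiveAt (embed b) y) := by
    intro b
    simp only [hH, St_embed]
    simp
  apply le_antisymm
  · refine iSup_le fun k => ?_
    change _ ≤ H σ
    induction k generalizing σ with
    | zero =>
      rw [FL_zero_active ξ (x := y)]
      · exact zero_le
      · simp [addActiveAt, addActive_isActive]
    | succ k ih =>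
      by_cases h : (activeSites σ).Nonempty
      · obtain ⟨x, hx⟩ := h
        rw [mem_activeSites] at hx
        rw [FL_abelian ξ k (isActive_add hx y), ← Hharm hx]
        unfold Top
        gcongr with i
        rw [act_add hx]
        exact ih _
      · obtain ⟨b, rfl⟩ := stable_embed h
        rw [Hst]
        exact le_iSup (fun k => FL K l ξ k (addActiveAt (embed b) y)) (k+1)
  · have : ∀ k σ, ∑ η, FL K l η k σ * St K l ξ (addActiveAt (embed η) y)
        ≤ St K l ξ (addActiveAt σ y) := by
      intro k
      induction k with
      | zero =>
        intro σ
        by_cases h : (activeSites σ).Nonempty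
        · obtain ⟨x, hx⟩ := h
          simp [FL_zero_active _ (mem_activeSites.1 hx)]
        · obtain ⟨b, rfl⟩ := stable_embed h
          have : ∀ η, FL K l η 0 (embed b) = if b = η then 1 else 0 := by
            intro η
            by_cases e : b = η
            · simp [FL, e]
            · rw [FL_stable _ _ (embed_not_active b), if_neg e, if_neg fun e' => e (embed_inj e')]
          simp [this]
      | succ k ih =>
        intro σ
        by_cases h : (activeSites σ).Nonempty
        · obtain ⟨x, hx⟩ := h
          rw [mem_activeSites] at hx
          rw [← St_harm ξ (isActive_add hx y)]
          simp only [FL_abelian _ k hx, Top, Finset.sum_mul]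
          rw [Finset.sum_comm]
          gcongr with i
          rw [act_add hx]
          refine le_trans (le_of_eq ?_) (mul_le_mul_right (ih (act x i σ)) _)
          rw [Finset.mul_sum]
          exact Finset.sum_congr rfl fun η _ => by ring
        · refine le_trans (le_of_eq ?_) (ih σ)
          simp only [FL_stable _ _ h]
    have e : H σ = ⨆ k, ∑ η, FL K l η k σ * St K l ξ (addActiveAt (embed η) y) := by
      simp only [hH, St, ENNReal.iSup_mul]
      rw [ENNReal.finsetSum_iSup_of_monotone]
      intro η a b hab
      exact mul_le_mul_left (FL_mono η hab _) _
    change H σ ≤ _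
    rw [e]
    exact iSup_le fun k => this k σ

end abelian

end ARW

namespace ARW

section frozen

set_option linter.unusedSectionVars false

variable {V : Type} [Fintype V] [DecidableEq V] {K : V → V → ℝ≥0∞} {l : ℝ≥0∞}

/-- forced move -/
noncomputable def Uop (K : V → V → ℝ≥0∞) (x : V) (f : Conf V → ℝ≥0∞) (σ : Conf V) : ℝ≥0∞ :=
  (∑ y, K x y * f (addActiveAt (loc x Site.removeOne σ) y))
    + (1 - ∑ y, K x y) * f (loc x Site.removeOne σ)

theorem Top_eq (x : V) (f : Conf V → ℝ≥0∞) (σ : Conf V) :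
    Top K l x f σ = (l * f (loc x Site.slp σ) + Uop K x f σ) / (l + 1) := by
  unfold Top Uop
  rw [Fintype.sum_option, Fintype.sum_option]
  simp only [wt, act, div_eq_mul_inv, add_mul, Finset.sum_mul]
  rw [add_comm (∑ i, _) (_ * _ * _)]
  congr 1
  · ring
  · congr 1
    · ring
    · exact Finset.sum_congr rfl fun y _ => by ring

theorem slp_of_ne {s : Site} (h : s ≠ Site.active 0) : s.slp = s := by
  cases s with
  | empty => rfl
  | sleeping => rfl
  | active n =>
    cases n with
    | zero => exact absurd rfl h
    | succ n => rfl

theorem loc_slp_of_ne {σ : Conf V} {x : V} (h : σ x ≠ Site.active 0) :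
    loc x Site.slp σ = σ := by
  unfold loc; rw [slp_of_ne h]; simp

theorem Uop_of_harm (hl : l ≠ ⊤) {f : Conf V → ℝ≥0∞} {σ : Conf V} {x : V} (hf : f σ ≠ ⊤)
    (h : σ x ≠ Site.active 0) : Top K l x f σ = f σ ↔ Uop K x f σ = f σ := by
  have h1 : l + 1 ≠ 0 := by simp
  have h2 : l + 1 ≠ ⊤ := by simp [hl]
  rw [Top_eq, loc_slp_of_ne h, eq_comm, ENNReal.eq_div_iff h1 h2, add_mul, one_mul, eq_comm]
  exact ENNReal.add_right_inj (ENNReal.mul_ne_top hl hf)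

/-- the frozen operator -/
noncomputable def Nop (K : V → V → ℝ≥0∞) (l : ℝ≥0∞) (x : V) (f : Conf V → ℝ≥0∞) (σ : Conf V) :
    ℝ≥0∞ := if σ x = Site.active 0 then Top K l x f σ else Uop K x f σ

theorem Nop_mono (x : V) {f g : Conf V → ℝ≥0∞} (h : ∀ σ, f σ ≤ g σ) (σ : Conf V) :
    Nop K l x f σ ≤ Nop K l x g σ := by
  unfold Nop
  split_ifs
  · exact Top_mono x fun i => h _
  · unfold Uop
    gcongr
    · exact h _
    · exact h _

theorem Nop_eq_iff (hl : l ≠ ⊤) {f : Conf V → ℝ≥0∞} {σ : Conf V} {x : V} (hf : f σ ≠ ⊤) :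
    Nop K l x f σ = f σ ↔ Top K l x f σ = f σ := by
  unfold Nop
  split_ifs with h
  · rfl
  · exact (Uop_of_harm hl hf h).symm

theorem tsum_ind (a : Conf V) (c : ℝ≥0∞) (f : Conf V → ℝ≥0∞) :
    ∑' τ, (if τ = a then c else 0) * f τ = c * f a := by
  simp only [ite_mul, zero_mul]
  rw [tsum_eq_single a]
  · simp
  · intro b hb; simp [hb]

theorem tsum_move (x : V) (a : V → Conf V) (a0 : Conf V) (c0 : ℝ≥0∞) (f : Conf V → ℝ≥0∞) :
    ∑' τ, ((∑ y, if τ = a y then K x y else 0) + (if τ = a0 then c0 else 0)) * f τ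
      = (∑ y, K x y * f (a y)) + c0 * f a0 := by
  simp only [add_mul, Finset.sum_mul]
  rw [ENNReal.tsum_add, tsum_ind, Summable.tsum_finsetSum fun _ _ => ENNReal.summable]
  simp only [tsum_ind]

theorem tsum_topple (lam : ℝ) (σ : Conf V) (f : Conf V → ℝ≥0∞) :
    ∑' τ, toppleKernel K lam σ τ * f τ
      = if h : (activeSites σ).Nonempty then Nop K (ENNReal.ofReal lam) h.choose f σ
        else f σ := by
  split_ifs with h
  · simp only [toppleKernel, dif_pos h]
    unfold Nop
    split_ifs with h0
    · rw [Top_eq]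
      simp only [div_eq_mul_inv]
      set l := ENNReal.ofReal lam
      have e : loc h.choose Site.slp σ = Function.update σ h.choose Site.sleeping := by
        unfold loc; rw [h0]; rfl
      rw [e, Uop, ← tsum_move, ← tsum_ind, ← ENNReal.tsum_add, ← ENNReal.tsum_mul_right]
      refine tsum_congr fun τ => ?_
      rw [← add_mul, add_assoc]
      unfold loc
      ring
    · exact tsum_move _ _ _ _ _
  · simp only [toppleKernel, dif_neg h]
    rw [tsum_ind, one_mul]

/-- the frozen absorption law -/
theorem iSup_kernelPow (hsub : SubStochastic K) (lam : ℝ) (ξ : V → Bool) (σ : Conf V) :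
    ⨆ t, kernelPow (toppleKernel K lam) t σ (embed ξ) = St K (ENNReal.ofReal lam) ξ σ := by
  set l := ENNReal.ofReal lam with hl0
  have hl : l ≠ ⊤ := ENNReal.ofReal_ne_top
  set FK : ℕ → Conf V → ℝ≥0∞ := fun t σ => kernelPow (toppleKernel K lam) t σ (embed ξ) with hFK
  have rec0 : ∀ σ, FK 0 σ = if σ = embed ξ then 1 else 0 := by
    intro σ; simp only [hFK, kernelPow, eq_comm]
  have rec1 : ∀ t σ, FK (t+1) σ = if h : (activeSites σ).Nonempty then
      Nop K l h.choose (FK t) σ else FK t σ := by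
    intro t σ
    rw [hl0, ← tsum_topple]
    rfl
  have hle : ∀ t σ, FK t σ ≤ St K l ξ σ := by
    intro t
    induction t with
    | zero =>
      intro σ
      rw [rec0]
      split_ifs with h
      · rw [h, St_embed]; simp
      · exact zero_le
    | succ t ih =>
      intro σ
      rw [rec1]
      split_ifs with h
      · refine (Nop_mono _ ih σ).trans (le_of_eq ?_)
        rw [Nop_eq_iff hl (ne_top_of_le_ne_top ENNReal.one_ne_top (St_le_one hsub hl ξ σ))]
        exact St_harm ξ (mem_activeSites.1 h.choose_spec)
      · exact ih σ
  have hmono : Monotone FK := by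
    refine monotone_nat_of_le_succ fun t => ?_
    induction t with
    | zero =>
      intro σ
      rw [rec1]
      split_ifs with h
      · rw [rec0, if_neg]
        · exact zero_le
        · rintro rfl; exact embed_not_active ξ h
      · exact le_rfl
    | succ t ih =>
      intro σ
      rw [rec1 (t+1), rec1 t]
      split_ifs with h
      · exact Nop_mono _ ih σ
      · exact le_rfl
  apply le_antisymm
  · exact iSup_le fun t => hle t σ
  · refine St_minimal ξ (fun σ => ⨆ t, FK t σ) ?_ ?_ σ
    · exact le_iSup_of_le 0 (by rw [rec0]; simp)
    · intro σ h
      have fin : (⨆ t, FK t σ) ≠ ⊤ := ne_top_of_le_ne_top ENNReal.one_ne_top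
        ((iSup_le fun t => hle t σ).trans (St_le_one hsub hl ξ σ))
      refine le_of_eq ((Nop_eq_iff hl (f := fun σ => ⨆ t, FK t σ) fin).1 ?_)
      have : Nop K l h.choose (fun σ => ⨆ t, FK t σ) σ = ⨆ t, Nop K l h.choose (FK t) σ := by
        unfold Nop
        split_ifs with h0
        · exact Top_iSup _ _ hmono σ
        · unfold Uop
          simp only [ENNReal.mul_iSup]
          rw [ENNReal.finsetSum_iSup_of_monotone, ENNReal.iSup_add_iSup_of_monotone]
          · intro a b hab
            exact Finset.sum_le_sum fun y _ => mul_le_mul_right (hmono hab _) _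
          · intro a b hab
            exact mul_le_mul_right (hmono hab _) _
          · intro y a b hab
            exact mul_le_mul_right (hmono hab _) _
      rw [this]
      apply le_antisymm
      · refine iSup_le fun t => ?_
        have := rec1 t σ
        rw [dif_pos h] at this
        rw [← this]
        exact le_iSup (fun t => FK t σ) (t+1)
      · refine iSup_le fun t => (hmono (Nat.le_succ t) σ).trans ?_
        rw [Nat.succ_eq_add_one, rec1 t σ, dif_pos h]
        exact le_iSup (fun t => Nop K l h.choose (FK t) σ) t

theorem arwStep_eq (hsub : SubStochastic K) (lam : ℝ) (ν : V → ℝ≥0∞) (η ξ : V → Bool) :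
    arwStep K lam ν η ξ
      = ∑ y, ν y * St K (ENNReal.ofReal lam) ξ (addActiveAt (embed η) y) := by
  unfold arwStep
  simp only [iSup_kernelPow hsub]

end frozen

end ARW

namespace ARW

section walks

set_option linter.unusedSectionVars false

variable {V : Type} [Fintype V] [DecidableEq V] {K : V → V → ℝ≥0∞}

theorem K_ne_top (hsub : SubStochastic K) (x y : V) : K x y ≠ ⊤ :=
  ne_top_of_le_ne_top ENNReal.one_ne_top
    ((Finset.single_le_sum (f := fun y => K x y) (fun _ _ => zero_le) (Finset.mem_univ y)).trans
      (hsub x))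

theorem maxprinc (hsub : SubStochastic K) (hnd : NonDegenerate K) (S : Finset V)
    {f g e : V → ℝ≥0∞} (hf : ∀ y, f y ≠ ⊤) (hg : ∀ y, g y ≠ ⊤)
    (hoff : ∀ y, y ∉ S → f y ≤ g y)
    (hfS : ∀ y ∈ S, f y ≤ (∑ z, K y z * f z) + e y)
    (hgS : ∀ y ∈ S, (∑ z, K y z * g z) + e y ≤ g y) (y : V) : f y ≤ g y := by
  by_contra hy
  rw [not_le] at hy
  have hK := K_ne_top hsub
  set d : V → ℝ := fun y => (f y).toReal - (g y).toReal with hd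
  have hdy : 0 < d y := by
    simp only [hd, sub_pos]
    exact (ENNReal.toReal_lt_toReal (hg y) (hf y)).2 hy
  have : Nonempty V := ⟨y⟩
  obtain ⟨x0, hx0⟩ := Finite.exists_max d
  set M := d x0 with hM
  have hMpos : 0 < M := hdy.trans_le (hx0 y)
  set S' : Finset V := Finset.univ.filter fun x => d x = M with hS'
  have hne : S'.Nonempty := ⟨x0, by simp [hS', hM]⟩
  obtain ⟨x, hx, hx1⟩ := hnd S' hne
  have hxM : d x = M := by simpa [hS'] using hx
  have hxS : x ∈ S := by
    by_contra hxS
    have h1 := (ENNReal.toReal_le_toReal (hf x) (hg x)).2 (hoff x hxS)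
    have : d x ≤ 0 := by simp only [hd]; linarith
    linarith
  have heT : e x ≠ ⊤ := ne_top_of_le_ne_top (hg x) (le_trans le_add_self (hgS x hxS))
  have hsT : ∀ (h : V → ℝ≥0∞), (∀ y, h y ≠ ⊤) → (∑ z, K x z * h z) ≠ ⊤ := by
    intro h hh
    exact ENNReal.sum_ne_top.2 fun z _ => ENNReal.mul_ne_top (hK x z) (hh z)
  have tr : ∀ (h : V → ℝ≥0∞), (∀ y, h y ≠ ⊤) →
      ((∑ z, K x z * h z) + e x).toReal
        = (∑ z, (K x z).toReal * (h z).toReal) + (e x).toReal := by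
    intro h hh
    rw [ENNReal.toReal_add (hsT h hh) heT,
      ENNReal.toReal_sum fun z _ => ENNReal.mul_ne_top (hK x z) (hh z)]
    simp only [ENNReal.toReal_mul]
  have a1 := ENNReal.toReal_mono (ENNReal.add_ne_top.2 ⟨hsT f hf, heT⟩) (hfS x hxS)
  have a2 := ENNReal.toReal_mono (hg x) (hgS x hxS)
  rw [tr f hf] at a1
  rw [tr g hg] at a2
  have a3 : M ≤ ∑ z, (K x z).toReal * d z := by
    rw [← hxM]
    simp only [hd, mul_sub, Finset.sum_sub_distrib]
    linarith
  have a4 : ∑ z, (K x z).toReal ≤ 1 := by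
    rw [← ENNReal.toReal_sum fun z _ => hK x z]
    simpa using ENNReal.toReal_mono ENNReal.one_ne_top (hsub x)
  have hnn : ∀ z ∈ Finset.univ, 0 ≤ (K x z).toReal * (M - d z) := fun z _ =>
    mul_nonneg ENNReal.toReal_nonneg (sub_nonneg.2 (hx0 z))
  have a5 : ∑ z, (K x z).toReal * (M - d z) = M * (∑ z, (K x z).toReal)
      - ∑ z, (K x z).toReal * d z := by
    simp only [mul_sub, Finset.sum_sub_distrib, Finset.mul_sum]
    congr 1
    exact Finset.sum_congr rfl fun z _ => mul_comm _ _
  have a6 : ∑ z, (K x z).toReal * (M - d z) = 0 := by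
    apply le_antisymm
    · rw [a5]; nlinarith
    · exact Finset.sum_nonneg hnn
  have a7 : ∑ z, (K x z).toReal = 1 := by
    apply le_antisymm a4
    rw [a6] at a5
    by_contra hlt
    rw [not_le] at hlt
    nlinarith
  rw [Finset.sum_eq_zero_iff_of_nonneg hnn] at a6
  apply hx1
  have a8 : ∑ z ∈ S', K x z = ∑ z, K x z := by
    refine Finset.sum_subset (Finset.subset_univ _) fun z _ hz => ?_
    have := a6 z (Finset.mem_univ z)
    rcases mul_eq_zero.1 this with h | h
    · exact ((ENNReal.toReal_eq_zero_iff _).1 h).resolve_right (hK x z)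
    · exfalso; apply hz; simp only [hS', Finset.mem_filter, Finset.mem_univ, true_and]; linarith
  rw [a8]
  rw [← ENNReal.toReal_sum fun z _ => hK x z] at a7
  exact (ENNReal.toReal_eq_one_iff _).1 a7

theorem harm_unique (hsub : SubStochastic K) (hnd : NonDegenerate K) (S : Finset V)
    {f g e : V → ℝ≥0∞} (hf : ∀ y, f y ≠ ⊤) (hg : ∀ y, g y ≠ ⊤)
    (hoff : ∀ y, y ∉ S → f y = g y)
    (hfS : ∀ y ∈ S, f y = (∑ z, K y z * f z) + e y)
    (hgS : ∀ y ∈ S, g y = (∑ z, K y z * g z) + e y) (y : V) : f y = g y :=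
  le_antisymm
    (maxprinc hsub hnd S hf hg (fun y h => (hoff y h).le) (fun y h => (hfS y h).le)
      (fun y h => (hgS y h).ge) y)
    (maxprinc hsub hnd S hg hf (fun y h => (hoff y h).ge) (fun y h => (hgS y h).le)
      (fun y h => (hfS y h).ge) y)

/-- lists are empty or a cons -/
def listEquiv (V : Type) : Option (V × List V) ≃ List V where
  toFun o := match o with
    | none => []
    | some (x, w) => x :: w
  invFun w := match w with
    | [] => none
    | x :: w => some (x, w)
  left_inv o := by rcases o with _ | ⟨x, w⟩ <;> rfl
  right_inv w := by cases w <;> rfl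

theorem tsum_listV (f : List V → ℝ≥0∞) :
    ∑' w, f w = f [] + ∑ y, ∑' w, f (y :: w) := by
  rw [← (listEquiv V).tsum_eq f, ENNReal.tsum_eq_add_tsum_ite none]
  congr 1
  trans ∑' o : Option (V × List V), Option.elim o 0 (fun p => f (p.1 :: p.2))
  · refine tsum_congr fun o => ?_
    rcases o with _ | ⟨x, w⟩
    · simp
    · simp [listEquiv]
  · rw [← tsum_fintype (L := SummationFilter.unconditional V), ← ENNReal.tsum_prod (f := fun y w => f (y :: w))]
    symm
    refine Function.Injective.tsum_eq (g := (some : V × List V → Option (V × List V)))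
      (Option.some_injective _) (f := fun o => Option.elim o 0 fun p => f (p.1 :: p.2)) ?_
    intro o ho
    rcases o with _ | p
    · simp at ho
    · exact ⟨p, rfl⟩

theorem tsum_path (y : V) (φ : List V → ℝ≥0∞) :
    ∑' w, pathProb K y w * φ w
      = (∑ z, K y z * ∑' w, pathProb K z w * φ (z :: w)) + (1 - ∑ z, K y z) * φ [] := by
  rw [tsum_listV, add_comm]
  simp only [pathProb, mul_assoc, ENNReal.tsum_mul_left]

theorem tsum_walk (ν : V → ℝ≥0∞) (φ : List V → ℝ≥0∞) :
    ∑' w, walkProb K ν w * φ w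
      = ∑ y, ν y * ∑' w, pathProb K y w * φ (y :: w) := by
  rw [tsum_listV]
  simp only [walkProb, mul_assoc, ENNReal.tsum_mul_left, zero_mul, zero_add]

theorem path_mass_le (hsub : SubStochastic K) (y : V) : ∑' w, pathProb K y w ≤ 1 := by
  have key : ∀ k y, ∑' w, pathProb K y w * (if w.length < k then 1 else 0) ≤ 1 := by
    intro k
    induction k with
    | zero => intro y; simp
    | succ k ih =>
      intro y
      rw [tsum_path]
      simp only [List.length_cons, add_lt_add_iff_right, List.length_nil]
      calc _ ≤ (∑ z, K y z * 1) + (1 - ∑ z, K y z) * 1 := by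
            gcongr with z
            · exact ih z
            · split_ifs <;> simp
        _ = 1 := by simp only [mul_one]; exact add_tsub_cancel_of_le (hsub y)
  rw [ENNReal.tsum_eq_iSup_sum]
  refine iSup_le fun s => ?_
  refine le_trans ?_ (key ((s.sup List.length) + 1) y)
  refine le_trans (Finset.sum_le_sum fun w hw => ?_) (ENNReal.sum_le_tsum s)
  rw [if_pos (Nat.lt_succ_of_le (Finset.le_sup hw)), mul_one]

theorem path_mass (hsub : SubStochastic K) (hnd : NonDegenerate K) (y : V) :
    ∑' w, pathProb K y w = 1 := by
  refine harm_unique hsub hnd Finset.univ (e := fun y => 1 - ∑ z, K y z)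
    (f := fun y => ∑' w, pathProb K y w) (g := fun _ => 1)
    (fun y => ne_top_of_le_ne_top ENNReal.one_ne_top (path_mass_le hsub y)) (by simp)
    (fun y hy => absurd (Finset.mem_univ y) hy) ?_ ?_ y
  · intro y _
    have := tsum_path (K := K) y (fun _ => 1)
    simpa only [mul_one] using this
  · intro y _
    simp only [mul_one]; exact (add_tsub_cancel_of_le (hsub y)).symm

/-- probability to hit `x` from `y` -/
noncomputable def qh (K : V → V → ℝ≥0∞) (x y : V) : ℝ≥0∞ :=
  ∑' w, pathProb K y w * (if x ∈ y :: w then 1 else 0)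

theorem qh_le_one (hsub : SubStochastic K) (x y : V) : qh K x y ≤ 1 := by
  refine le_trans (ENNReal.tsum_le_tsum fun w => ?_) (path_mass_le hsub y)
  split_ifs <;> simp

theorem qh_harm (x y : V) (h : x ≠ y) : qh K x y = ∑ z, K y z * qh K x z := by
  unfold qh
  rw [tsum_path]
  simp [h]

theorem hitProb_eq (ν : V → ℝ≥0∞) (x : V) : hitProb K ν x = ∑ y, ν y * qh K x y := by
  unfold hitProb qh
  rw [← tsum_walk ν (fun w => if x ∈ w then 1 else 0)]
  simp

/-- IDLA from `y` -/
noncomputable def uf (K : V → V → ℝ≥0∞) (Φ : Finset V → ℝ≥0∞) (B : Finset V) (y : V) : ℝ≥0∞ :=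
  ∑' w, pathProb K y w * Φ (idlaUpdate B (y :: w))

/-- IDLA transition operator -/
noncomputable def Qop (K : V → V → ℝ≥0∞) (ν : V → ℝ≥0∞) (Φ : Finset V → ℝ≥0∞) (B : Finset V) :
    ℝ≥0∞ := ∑' w, walkProb K ν w * Φ (idlaUpdate B w)

theorem Qop_eq (ν : V → ℝ≥0∞) (Φ : Finset V → ℝ≥0∞) (B : Finset V) :
    Qop K ν Φ B = ∑ y, ν y * uf K Φ B y := tsum_walk ν _

theorem uf_off (hsub : SubStochastic K) (hnd : NonDegenerate K) (Φ : Finset V → ℝ≥0∞)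
    {B : Finset V} {y : V} (h : y ∉ B) : uf K Φ B y = Φ (insert y B) := by
  unfold uf
  simp only [idlaUpdate, if_neg h]
  rw [ENNReal.tsum_mul_right, path_mass hsub hnd, one_mul]

theorem uf_on (Φ : Finset V → ℝ≥0∞)
    {B : Finset V} {y : V} (h : y ∈ B) :
    uf K Φ B y = (∑ z, K y z * uf K Φ B z) + (1 - ∑ z, K y z) * Φ B := by
  have e : ∀ w, idlaUpdate B (y :: w) = idlaUpdate B w := fun w => by
    simp only [idlaUpdate, if_pos h]
  unfold uf
  simp only [e]
  rw [tsum_path]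
  rfl

theorem uf_le (hsub : SubStochastic K) {Φ : Finset V → ℝ≥0∞} {C : ℝ≥0∞} (hC : ∀ B, Φ B ≤ C)
    (B : Finset V) (y : V) : uf K Φ B y ≤ C := by
  calc uf K Φ B y ≤ ∑' w, pathProb K y w * C := by
        refine ENNReal.tsum_le_tsum fun w => ?_
        gcongr
        exact hC _
    _ ≤ 1 * C := by rw [ENNReal.tsum_mul_right]; gcongr; exact path_mass_le hsub y
    _ = C := one_mul C

theorem uf_unique (hsub : SubStochastic K) (hnd : NonDegenerate K) {Φ : Finset V → ℝ≥0∞}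
    (hC : ∀ B, Φ B ≤ 1) {B : Finset V} {h : V → ℝ≥0∞} (hT : ∀ y, h y ≠ ⊤)
    (hoff : ∀ y, y ∉ B → h y = Φ (insert y B))
    (hon : ∀ y ∈ B, h y = (∑ z, K y z * h z) + (1 - ∑ z, K y z) * Φ B) (y : V) :
    h y = uf K Φ B y :=
  harm_unique hsub hnd B hT
    (fun y => ne_top_of_le_ne_top ENNReal.one_ne_top (uf_le hsub hC B y))
    (fun y hy => by rw [hoff y hy, uf_off hsub hnd Φ hy]) hon (fun y hy => uf_on Φ hy) y

theorem Qop_mono (ν : V → ℝ≥0∞) {Φ Φ' : Finset V → ℝ≥0∞} (h : ∀ B, Φ B ≤ Φ' B) (B : Finset V) :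
    Qop K ν Φ B ≤ Qop K ν Φ' B := by
  unfold Qop
  refine ENNReal.tsum_le_tsum fun w => ?_
  gcongr
  exact h _

theorem Qop_add (ν : V → ℝ≥0∞) (Φ Φ' : Finset V → ℝ≥0∞) (B : Finset V) :
    Qop K ν (fun B => Φ B + Φ' B) B = Qop K ν Φ B + Qop K ν Φ' B := by
  unfold Qop
  rw [← ENNReal.tsum_add]
  simp only [mul_add]

theorem Qop_mul (ν : V → ℝ≥0∞) (c : ℝ≥0∞) (Φ : Finset V → ℝ≥0∞) (B : Finset V) :
    Qop K ν (fun B => c * Φ B) B = c * Qop K ν Φ B := by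
  unfold Qop
  rw [← ENNReal.tsum_mul_left]
  exact tsum_congr fun w => by ring

theorem Qop_sum {ι : Type} (s : Finset ι) (ν : V → ℝ≥0∞) (Φ : ι → Finset V → ℝ≥0∞) (B : Finset V) :
    Qop K ν (fun B => ∑ i ∈ s, Φ i B) B = ∑ i ∈ s, Qop K ν (Φ i) B := by
  unfold Qop
  rw [← Summable.tsum_finsetSum fun _ _ => ENNReal.summable]
  simp only [Finset.mul_sum]

theorem Qop_const (hsub : SubStochastic K) (hnd : NonDegenerate K) {ν : V → ℝ≥0∞}
    (hν : IsProbVec ν) (c : ℝ≥0∞) (B : Finset V) : Qop K ν (fun _ => c) B = c := by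
  rw [Qop_eq]
  unfold uf
  simp only [ENNReal.tsum_mul_right, path_mass hsub hnd, one_mul]
  rw [← Finset.sum_mul, hν, one_mul]

/-- iterates -/
noncomputable def Qit (K : V → V → ℝ≥0∞) (ν : V → ℝ≥0∞) : ℕ → (Finset V → ℝ≥0∞) →
    Finset V → ℝ≥0∞
  | 0, Φ => Φ
  | t + 1, Φ => Qop K ν (Qit K ν t Φ)

theorem Qit_mono (ν : V → ℝ≥0∞) (t : ℕ) {Φ Φ' : Finset V → ℝ≥0∞} (h : ∀ B, Φ B ≤ Φ' B) :
    ∀ B, Qit K ν t Φ B ≤ Qit K ν t Φ' B := by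
  induction t with
  | zero => exact h
  | succ t ih => exact Qop_mono ν ih

theorem Qit_add (ν : V → ℝ≥0∞) (t : ℕ) (Φ Φ' : Finset V → ℝ≥0∞) :
    Qit K ν t (fun B => Φ B + Φ' B) = fun B => Qit K ν t Φ B + Qit K ν t Φ' B := by
  induction t with
  | zero => rfl
  | succ t ih => funext B; simp only [Qit]; rw [ih, Qop_add]

theorem Qit_mul (ν : V → ℝ≥0∞) (t : ℕ) (c : ℝ≥0∞) (Φ : Finset V → ℝ≥0∞) :
    Qit K ν t (fun B => c * Φ B) = fun B => c * Qit K ν t Φ B := by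
  induction t with
  | zero => rfl
  | succ t ih => funext B; simp only [Qit]; rw [ih, Qop_mul]

theorem Qit_sum {ι : Type} (s : Finset ι) (ν : V → ℝ≥0∞) (t : ℕ) (Φ : ι → Finset V → ℝ≥0∞) :
    Qit K ν t (fun B => ∑ i ∈ s, Φ i B) = fun B => ∑ i ∈ s, Qit K ν t (Φ i) B := by
  induction t with
  | zero => rfl
  | succ t ih => funext B; simp only [Qit]; rw [ih, Qop_sum]

theorem Qit_const (hsub : SubStochastic K) (hnd : NonDegenerate K) {ν : V → ℝ≥0∞}
    (hν : IsProbVec ν) (t : ℕ) (c : ℝ≥0∞) : Qit K ν t (fun _ => c) = fun _ => c := by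
  induction t with
  | zero => rfl
  | succ t ih => funext B; simp only [Qit]; rw [ih, Qop_const hsub hnd hν]

theorem subset_idla (B : Finset V) (w : List V) : B ⊆ idlaUpdate B w := by
  induction w with
  | nil => exact Finset.Subset.refl _
  | cons x w ih =>
    unfold idlaUpdate
    split_ifs
    · exact ih
    · exact Finset.subset_insert x B

/-- the tail of the filling time -/
noncomputable def Rt (K : V → V → ℝ≥0∞) (ν : V → ℝ≥0∞) (t : ℕ) : ℝ≥0∞ :=
  Qit K ν t (fun B => if B = Finset.univ then 0 else 1) ∅

/-- exponential supermartingale -/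
noncomputable def Hx (K : V → V → ℝ≥0∞) (c : ℝ≥0∞) (x : V) (B : Finset V) : ℝ≥0∞ :=
  if x ∈ B then 0 else ∏ y ∈ B, (1 - c * qh K x y)

theorem Hx_le_one (c : ℝ≥0∞) (x : V) (B : Finset V) : Hx K c x B ≤ 1 := by
  unfold Hx
  split_ifs
  · exact zero_le
  · exact Finset.prod_le_one' fun y _ => tsub_le_self

theorem Qop_Hx (hsub : SubStochastic K) (hnd : NonDegenerate K) {ν : V → ℝ≥0∞}
    (hν : IsProbVec ν) {c : ℝ≥0∞} (hc : c ≤ 1) (x : V) (B : Finset V) :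
    Qop K ν (Hx K c x) B ≤ (1 - c * hitProb K ν x) * Hx K c x B := by
  have hcq : ∀ y, c * qh K x y ≤ 1 := fun y => mul_le_one' hc (qh_le_one hsub x y)
  by_cases hx : x ∈ B
  · have : Qop K ν (Hx K c x) B = 0 := by
      unfold Qop
      rw [ENNReal.tsum_eq_zero]
      intro w
      rw [Hx, if_pos (subset_idla B w hx), mul_zero]
    rw [this]; exact zero_le
  · set G : ℝ≥0∞ := Hx K c x B with hG
    have hG1 : G ≤ 1 := Hx_le_one c x B
    have hGT : G ≠ ⊤ := ne_top_of_le_ne_top ENNReal.one_ne_top hG1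
    have key : ∀ y, uf K (Hx K c x) B y + G * (c * qh K x y) ≤ G := by
      refine maxprinc hsub hnd B (f := fun y => uf K (Hx K c x) B y + G * (c * qh K x y))
        (g := fun _ => G) (e := fun y => (1 - ∑ z, K y z) * G) ?_ (fun _ => hGT) ?_ ?_ ?_
      · intro y
        refine ENNReal.add_ne_top.2 ⟨ne_top_of_le_ne_top ENNReal.one_ne_top
          (uf_le hsub (Hx_le_one c x) B y), ENNReal.mul_ne_top hGT
          (ne_top_of_le_ne_top ENNReal.one_ne_top (hcq y))⟩
      · intro y hy
        rw [uf_off hsub hnd _ hy]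
        by_cases e : x = y
        · subst e
          rw [Hx, if_pos (Finset.mem_insert_self x B), zero_add]
          exact mul_le_of_le_one_right' (hcq x)
        · have hxi : x ∉ insert y B := by simp [e, hx]
          rw [hG, Hx, if_neg hxi, Finset.prod_insert hy, Hx, if_neg hx, mul_comm (_ - _),
            ← mul_add, tsub_add_cancel_of_le (hcq y), mul_one]
      · intro y hy
        have e : x ≠ y := by rintro rfl; exact hx hy
        rw [uf_on _ hy, qh_harm x y e, ← hG]
        apply le_of_eq
        simp only [mul_add, Finset.sum_add_distrib, Finset.mul_sum]
        rw [add_right_comm]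
        congr 2
        exact Finset.sum_congr rfl fun z _ => by ring
      · intro y hy
        rw [← Finset.sum_mul, ← add_mul, add_tsub_cancel_of_le (hsub y), one_mul]
    have hp : c * hitProb K ν x ≠ ⊤ := by
      rw [hitProb_eq]
      refine ENNReal.mul_ne_top (ne_top_of_le_ne_top ENNReal.one_ne_top hc) ?_
      refine ne_top_of_le_ne_top (b := ∑ y, ν y * 1) ?_ ?_
      · simp only [mul_one]; rw [hν]; exact ENNReal.one_ne_top
      · gcongr with y; exact qh_le_one hsub x y
    have main : Qop K ν (Hx K c x) B + G * (c * hitProb K ν x) ≤ G := by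
      rw [Qop_eq, hitProb_eq]
      calc _ = ∑ y, ν y * (uf K (Hx K c x) B y + G * (c * qh K x y)) := by
            simp only [mul_add, Finset.sum_add_distrib, Finset.mul_sum]
            congr 1
            exact Finset.sum_congr rfl fun z _ => by ring
        _ ≤ ∑ y, ν y * G := by gcongr with y; exact key y
        _ = G := by rw [← Finset.sum_mul, hν, one_mul]
    rw [ENNReal.sub_mul fun _ _ => hGT, one_mul, mul_comm _ G]
    exact ENNReal.le_sub_of_add_le_right (ENNReal.mul_ne_top hGT hp) main

theorem Qit_Hx (hsub : SubStochastic K) (hnd : NonDegenerate K) {ν : V → ℝ≥0∞}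
    (hν : IsProbVec ν) {c : ℝ≥0∞} (hc : c ≤ 1) (x : V) (t : ℕ) (B : Finset V) :
    Qit K ν t (Hx K c x) B ≤ (1 - c * hitProb K ν x) ^ t * Hx K c x B := by
  induction t generalizing B with
  | zero => simp [Qit]
  | succ t ih =>
    simp only [Qit]
    refine (Qop_mono ν ih B).trans ?_
    rw [Qop_mul, pow_succ, mul_assoc]
    gcongr
    exact Qop_Hx hsub hnd hν hc x B

theorem tail_site (hsub : SubStochastic K) (hnd : NonDegenerate K) {ν : V → ℝ≥0∞}
    (hν : IsProbVec ν) {c : ℝ≥0∞} (hc : c ≤ 1) (x : V) (t : ℕ) :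
    (∏ y, (1 - c * qh K x y)) * Qit K ν t (fun B => if x ∈ B then 0 else 1) ∅
      ≤ (1 - c * hitProb K ν x) ^ t := by
  have h1 := Qit_Hx hsub hnd hν hc x t ∅
  have h2 : Hx K c x ∅ = 1 := by simp [Hx]
  rw [h2, mul_one] at h1
  refine le_trans ?_ h1
  have := congrFun (Qit_mul (K := K) ν t (∏ y, (1 - c * qh K x y))
    (fun B => if x ∈ B then 0 else 1)) ∅
  rw [← this]
  refine Qit_mono ν t (fun B => ?_) ∅
  unfold Hx
  split_ifs with hx
  · simp
  · rw [mul_one]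
    exact Finset.prod_le_prod_of_subset_of_le_one' (Finset.subset_univ B)
      fun y _ _ => tsub_le_self

theorem Rt_le_sum (ν : V → ℝ≥0∞) (t : ℕ) :
    Rt K ν t ≤ ∑ x, Qit K ν t (fun B => if x ∈ B then 0 else 1) ∅ := by
  have := congrFun (Qit_sum (K := K) Finset.univ ν t
    (fun (x : V) B => if x ∈ B then 0 else 1)) ∅
  rw [← this]
  refine Qit_mono ν t (fun B => ?_) ∅
  split_ifs with h
  · exact zero_le
  · obtain ⟨x, hx⟩ : ∃ x, x ∉ B := by
      by_contra hh
      push Not at hh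
      exact h (Finset.eq_univ_iff_forall.2 hh)
    refine le_trans ?_ (Finset.single_le_sum (fun _ _ => zero_le) (Finset.mem_univ x))
    rw [if_neg hx]

end walks

end ARW

namespace ARW

section link

set_option linter.unusedSectionVars false

variable {V : Type} [Fintype V] [DecidableEq V] {K : V → V → ℝ≥0∞} {l : ℝ≥0∞}

theorem St_ne_top (hsub : SubStochastic K) (hl : l ≠ ⊤) (ξ : V → Bool) (σ : Conf V) :
    St K l ξ σ ≠ ⊤ := ne_top_of_le_ne_top ENNReal.one_ne_top (St_le_one hsub hl ξ σ)

theorem rem_addActive {s : Site} (h : s.isActive = true) : s.addActive.removeOne = s := by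
  cases s with
  | empty => cases h
  | sleeping => cases h
  | active n => rfl

theorem addActive_ne {s : Site} (h : s.isActive = true) : s.addActive ≠ Site.active 0 := by
  cases s with
  | empty => cases h
  | sleeping => cases h
  | active n => intro h; cases h

theorem St_walk (hsub : SubStochastic K) (hl : l ≠ ⊤) (ξ : V → Bool) {σ : Conf V} {y : V}
    (h : (σ y).isActive = true) :
    St K l ξ (addActiveAt σ y)
      = (∑ z, K y z * St K l ξ (addActiveAt σ z)) + (1 - ∑ z, K y z) * St K l ξ σ := by
  have e0 : (addActiveAt σ y) y = (σ y).addActive := by simp [addActiveAt]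
  have e1 : (addActiveAt σ y) y ≠ Site.active 0 := by rw [e0]; exact addActive_ne h
  have e2 : ((addActiveAt σ y) y).isActive = true := by rw [e0]; exact addActive_isActive _
  have e3 := (Uop_of_harm (K := K) hl (St_ne_top hsub hl ξ _) e1).1 (St_harm ξ e2)
  have e4 : loc y Site.removeOne (addActiveAt σ y) = σ := by
    rw [addActiveAt_eq, loc_loc, rem_addActive h, Function.update_eq_self]
  rw [← e3, Uop, e4]

theorem St_add_full (hsub : SubStochastic K) (hnd : NonDegenerate K) (hl : l ≠ ⊤) (ξ : V → Bool)
    {σ : Conf V} (h : ∀ y, (σ y).isActive = true) (y : V) :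
    St K l ξ (addActiveAt σ y) = St K l ξ σ := by
  refine harm_unique hsub hnd Finset.univ (f := fun y => St K l ξ (addActiveAt σ y))
    (g := fun _ => St K l ξ σ) (e := fun y => (1 - ∑ z, K y z) * St K l ξ σ)
    (fun y => St_ne_top hsub hl ξ _) (fun y => St_ne_top hsub hl ξ _)
    (fun y hy => absurd (Finset.mem_univ y) hy) (fun y _ => St_walk hsub hl ξ (h y)) ?_ y
  intro y _
  rw [← Finset.sum_mul, ← add_mul, add_tsub_cancel_of_le (hsub y), one_mul]

/-- `η` plus one active particle on each site of `B` -/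
def Cf (η : V → Bool) (B : Finset V) : Conf V :=
  fun x => if x ∈ B then (embed η x).addActive else embed η x

/-- the exact-sampling law -/
noncomputable def mu (K : V → V → ℝ≥0∞) (l : ℝ≥0∞) (ξ : V → Bool) : ℝ≥0∞ :=
  St K l ξ (fun _ => Site.active 0)

theorem St_Cf_univ (hsub : SubStochastic K) (hnd : NonDegenerate K) (hl : l ≠ ⊤)
    (η ξ : V → Bool) : St K l ξ (Cf η Finset.univ) = mu K l ξ := by
  have key : ∀ D : Finset V,
      St K l ξ (fun x => if x ∈ D then Site.active 1 else Site.active 0) = mu K l ξ := by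
    intro D
    induction D using Finset.induction_on with
    | empty => simp [mu]
    | insert a D ha ih =>
      rw [← ih]
      refine Eq.trans ?_ (St_add_full hsub hnd hl ξ
        (σ := fun x => if x ∈ D then Site.active 1 else Site.active 0)
        (by intro y; split_ifs <;> rfl) a)
      congr 1
      funext x
      unfold addActiveAt
      by_cases e : x = a
      · subst e; simp [ha, Site.addActive]
      · simp [e]
  rw [← key (Finset.univ.filter fun x => η x = true)]
  congr 1
  funext x
  cases h : η x <;> simp [Cf, embed, h, Site.addActive]

theorem Cf_empty (η : V → Bool) : Cf η ∅ = embed η := by funext x; simp [Cf]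

theorem Cf_insert (η : V → Bool) {B : Finset V} {y : V} (h : y ∉ B) :
    addActiveAt (Cf η B) y = Cf η (insert y B) := by
  funext x
  unfold addActiveAt
  by_cases e : x = y
  · subst e; simp [Cf, h]
  · simp [Cf, e]

theorem St_Cf (hsub : SubStochastic K) (hnd : NonDegenerate K) (hl : l ≠ ⊤)
    (η ξ : V → Bool) (B : Finset V) (y : V) :
    St K l ξ (addActiveAt (Cf η B) y) = uf K (fun B => St K l ξ (Cf η B)) B y := by
  refine uf_unique hsub hnd (h := fun y => St K l ξ (addActiveAt (Cf η B) y))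
    (fun B => St_le_one hsub hl ξ _) (fun y => St_ne_top hsub hl ξ _)
    ?_ ?_ y
  · intro y hy; simp only [Cf_insert η hy]
  · intro y hy
    refine St_walk hsub hl ξ ?_
    simp [Cf, hy, addActive_isActive]

/-- the transition matrix in `ℝ≥0∞` -/
noncomputable def EM (K : V → V → ℝ≥0∞) (lam : ℝ) (ν : V → ℝ≥0∞) :
    Matrix (V → Bool) (V → Bool) ℝ≥0∞ := Matrix.of (arwStep K lam ν)

theorem EM_pow (hsub : SubStochastic K) (hnd : NonDegenerate K) (lam : ℝ) (ν : V → ℝ≥0∞)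
    (t : ℕ) (η ξ : V → Bool) :
    (EM K lam ν ^ t) η ξ
      = Qit K ν t (fun B => St K (ENNReal.ofReal lam) ξ (Cf η B)) ∅ := by
  set l := ENNReal.ofReal lam with hl0
  have hl : l ≠ ⊤ := ENNReal.ofReal_ne_top
  have key : ∀ t, (fun B => ∑ ζ, (EM K lam ν ^ t) ζ ξ * St K l ζ (Cf η B))
      = Qit K ν t (fun B => St K l ξ (Cf η B)) := by
    intro t
    induction t with
    | zero => funext B; simp [Qit, Matrix.one_apply]
    | succ t ih =>
      simp only [Qit]
      rw [← ih]
      funext B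
      rw [Qop_sum]
      have hQ : ∀ ζ', Qop K ν (fun B => (EM K lam ν ^ t) ζ' ξ * St K l ζ' (Cf η B)) B
          = (EM K lam ν ^ t) ζ' ξ * ∑ y, ν y * St K l ζ' (addActiveAt (Cf η B) y) := by
        intro ζ'
        rw [Qop_mul, Qop_eq]
        simp only [St_Cf hsub hnd hl]
      simp only [hQ]
      simp only [pow_succ', Matrix.mul_apply, Finset.sum_mul]
      rw [Finset.sum_comm]
      refine Finset.sum_congr rfl fun ζ' _ => ?_
      simp only [St_add ζ' _ (Cf η B)]
      simp only [EM, Matrix.of_apply, arwStep_eq hsub, ← hl0, Finset.mul_sum, Finset.sum_mul]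
      rw [Finset.sum_comm]
      refine Finset.sum_congr rfl fun y _ => Finset.sum_congr rfl fun ζ _ => ?_
      ring
  rw [← key t]
  simp [Cf_empty, St_embed]

theorem EM_lower (hsub : SubStochastic K) (hnd : NonDegenerate K) (lam : ℝ) {ν : V → ℝ≥0∞}
    (hν : IsProbVec ν) (t : ℕ) (η ξ : V → Bool) :
    mu K (ENNReal.ofReal lam) ξ ≤ (EM K lam ν ^ t) η ξ
      + mu K (ENNReal.ofReal lam) ξ * Rt K ν t := by
  have hl : ENNReal.ofReal lam ≠ ⊤ := ENNReal.ofReal_ne_top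
  have h1 := congrFun (Qit_const hsub hnd hν t (mu K (ENNReal.ofReal lam) ξ)) ∅
  have h2 := congrFun (Qit_mul (K := K) ν t (mu K (ENNReal.ofReal lam) ξ)
    (fun B => if B = Finset.univ then 0 else 1)) ∅
  rw [EM_pow hsub hnd, Rt, ← h2]
  refine le_trans h1.ge ?_
  have h3 := congrFun (Qit_add (K := K) ν t
    (fun B => St K (ENNReal.ofReal lam) ξ (Cf η B))
    (fun B => mu K (ENNReal.ofReal lam) ξ * (if B = Finset.univ then 0 else 1))) ∅
  rw [← h3]
  refine Qit_mono ν t (fun B => ?_) ∅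
  split_ifs with h
  · rw [h, St_Cf_univ hsub hnd hl]; simp
  · simp

theorem EM_upper (hsub : SubStochastic K) (hnd : NonDegenerate K) (lam : ℝ) {ν : V → ℝ≥0∞}
    (hν : IsProbVec ν) (t : ℕ) (η ξ : V → Bool) :
    (EM K lam ν ^ t) η ξ ≤ mu K (ENNReal.ofReal lam) ξ + Rt K ν t := by
  have hl : ENNReal.ofReal lam ≠ ⊤ := ENNReal.ofReal_ne_top
  have h1 := congrFun (Qit_const hsub hnd hν t (mu K (ENNReal.ofReal lam) ξ)) ∅
  rw [EM_pow hsub hnd, Rt]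
  have h3 := congrFun (Qit_add (K := K) ν t
    (fun _ => mu K (ENNReal.ofReal lam) ξ)
    (fun B => (if B = Finset.univ then 0 else 1))) ∅
  refine le_trans (Qit_mono ν t (fun B => ?_) ∅) (le_of_eq (h3.trans (by rw [h1])))
  split_ifs with h
  · rw [h, St_Cf_univ hsub hnd hl]; simp
  · exact le_trans (St_le_one hsub hl _ _) le_add_self

theorem Qit_ne_top (hsub : SubStochastic K) (hnd : NonDegenerate K) {ν : V → ℝ≥0∞}
    (hν : IsProbVec ν) (t : ℕ) {Φ : Finset V → ℝ≥0∞} (h : ∀ B, Φ B ≤ 1) (B : Finset V) :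
    Qit K ν t Φ B ≠ ⊤ := by
  refine ne_top_of_le_ne_top ENNReal.one_ne_top ?_
  have := congrFun (Qit_const hsub hnd hν t 1) B
  rw [← this]
  exact Qit_mono ν t h B

theorem Rt_ne_top (hsub : SubStochastic K) (hnd : NonDegenerate K) {ν : V → ℝ≥0∞}
    (hν : IsProbVec ν) (t : ℕ) : Rt K ν t ≠ ⊤ :=
  Qit_ne_top hsub hnd hν t (fun B => by split_ifs <;> simp) _

theorem EM_ne_top (hsub : SubStochastic K) (hnd : NonDegenerate K) (lam : ℝ) {ν : V → ℝ≥0∞}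
    (hν : IsProbVec ν) (t : ℕ) (η ξ : V → Bool) : (EM K lam ν ^ t) η ξ ≠ ⊤ := by
  rw [EM_pow hsub hnd]
  exact Qit_ne_top hsub hnd hν t (fun B => St_le_one hsub ENNReal.ofReal_ne_top _ _) _

theorem arwMatrix_pow (hsub : SubStochastic K) (hnd : NonDegenerate K) (lam : ℝ) {ν : V → ℝ≥0∞}
    (hν : IsProbVec ν) (t : ℕ) (η ξ : V → Bool) :
    (arwMatrix K lam ν ^ t) η ξ = ((EM K lam ν ^ t) η ξ).toReal := by
  induction t generalizing η ξ with
  | zero =>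
    simp only [pow_zero, Matrix.one_apply]
    split_ifs <;> simp
  | succ t ih =>
    have h1 := EM_ne_top hsub hnd lam hν 1
    rw [pow_succ', pow_succ', Matrix.mul_apply, Matrix.mul_apply, ENNReal.toReal_sum]
    · refine Finset.sum_congr rfl fun ζ _ => ?_
      rw [ENNReal.toReal_mul, ih]
      rfl
    · intro ζ _
      refine ENNReal.mul_ne_top ?_ (EM_ne_top hsub hnd lam hν t _ _)
      simpa using h1 η ζ

theorem stat_pow {S : Type} [Fintype S] [DecidableEq S] {P : Matrix S S ℝ} {π : S → ℝ}
    (h : IsStationary P π) (t : ℕ) (s : S) : ∑ r, π r * (P ^ t) r s = π s := by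
  induction t generalizing s with
  | zero => simp [Matrix.one_apply]
  | succ t ih =>
    simp only [pow_succ, Matrix.mul_apply, Finset.mul_sum]
    rw [Finset.sum_comm]
    simp only [← mul_assoc, ← Finset.sum_mul, ih]
    exact h.2.2 s

theorem stat_le (hsub : SubStochastic K) (hnd : NonDegenerate K) (lam : ℝ) {ν : V → ℝ≥0∞}
    (hν : IsProbVec ν) {π : (V → Bool) → ℝ} (hπ : IsStationary (arwMatrix K lam ν) π)
    (t : ℕ) (ξ : V → Bool) :
    π ξ ≤ (mu K (ENNReal.ofReal lam) ξ).toReal + (Rt K ν t).toReal := by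
  have hmu : mu K (ENNReal.ofReal lam) ξ ≠ ⊤ := St_ne_top hsub ENNReal.ofReal_ne_top _ _
  rw [← stat_pow hπ t ξ]
  calc _ ≤ ∑ r, π r * ((mu K (ENNReal.ofReal lam) ξ).toReal + (Rt K ν t).toReal) := by
        refine Finset.sum_le_sum fun r _ => mul_le_mul_of_nonneg_left ?_ (hπ.1 r)
        rw [arwMatrix_pow hsub hnd lam hν, ← ENNReal.toReal_add hmu (Rt_ne_top hsub hnd hν t)]
        exact ENNReal.toReal_mono (ENNReal.add_ne_top.2 ⟨hmu, Rt_ne_top hsub hnd hν t⟩)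
          (EM_upper hsub hnd lam hν t r ξ)
    _ = _ := by rw [← Finset.sum_mul, hπ.2.1, one_mul]

theorem real_lower (hsub : SubStochastic K) (hnd : NonDegenerate K) (lam : ℝ) {ν : V → ℝ≥0∞}
    (hν : IsProbVec ν) (t : ℕ) (η ξ : V → Bool) :
    (mu K (ENNReal.ofReal lam) ξ).toReal * (1 - (Rt K ν t).toReal)
      ≤ (arwMatrix K lam ν ^ t) η ξ := by
  have hmu : mu K (ENNReal.ofReal lam) ξ ≠ ⊤ := St_ne_top hsub ENNReal.ofReal_ne_top _ _
  have hT := ENNReal.mul_ne_top hmu (Rt_ne_top hsub hnd hν t)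
  have hE := EM_ne_top hsub hnd lam hν t η ξ
  have := ENNReal.toReal_mono (ENNReal.add_ne_top.2 ⟨hE, hT⟩) (EM_lower hsub hnd lam hν t η ξ)
  rw [ENNReal.toReal_add hE hT, ENNReal.toReal_mul] at this
  rw [arwMatrix_pow hsub hnd lam hν]
  linarith

theorem factor_bound {c q : ℝ} (hc0 : 0 ≤ c) (hc1 : c < 1) (hq0 : 0 ≤ q) (hq1 : q ≤ 1) :
    Real.exp (-(c / (1 - c) * q)) ≤ 1 - c * q := by
  have h1 : 0 < 1 - c := by linarith
  have hcq : c * q ≤ c := by nlinarith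
  have hcq0 : 0 ≤ c * q := by positivity
  have h2 : 0 < 1 - c * q := by linarith
  rw [Real.exp_neg, inv_le_comm₀ (Real.exp_pos _) h2]
  have h3 := Real.add_one_le_exp (c / (1 - c) * q)
  refine le_trans ?_ h3
  rw [inv_le_iff_one_le_mul₀ h2]
  have e : c / (1 - c) * q = c * q / (1 - c) := by ring
  rw [e]
  have h4 : c * q ≤ c * q / (1 - c) * (1 - c * q) := by
    rw [div_mul_eq_mul_div, le_div_iff₀ h1]
    nlinarith
  nlinarith

theorem hitProb_le_one (hsub : SubStochastic K) {ν : V → ℝ≥0∞}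
    (hν : IsProbVec ν) (x : V) : hitProb K ν x ≤ 1 := by
  rw [hitProb_eq]
  calc _ ≤ ∑ y, ν y * 1 := by gcongr with y; exact qh_le_one hsub x y
    _ = 1 := by simp only [mul_one]; exact hν

theorem tail_real (hsub : SubStochastic K) (hnd : NonDegenerate K) {ν : V → ℝ≥0∞}
    (hν : IsProbVec ν) {c : ℝ} (hc0 : 0 ≤ c) (hc1 : c < 1) (x : V) (t : ℕ) :
    (Qit K ν t (fun B => if x ∈ B then 0 else 1) ∅).toReal
      ≤ Real.exp (-(c * (hitProb K ν x).toReal * t) + c / (1 - c) * ∑ y, (qh K x y).toReal) := by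
  have hcE : ENNReal.ofReal c ≤ 1 := by simpa using hc1.le
  have h0 := tail_site hsub hnd hν hcE x t
  have hr : ∀ a : ℝ≥0∞, a ≤ 1 → (1 - ENNReal.ofReal c * a).toReal = 1 - c * a.toReal := by
    intro a ha
    rw [ENNReal.toReal_sub_of_le (mul_le_one' hcE ha) ENNReal.one_ne_top, ENNReal.toReal_mul,
      ENNReal.toReal_ofReal hc0, ENNReal.toReal_one]
  have h1 := ENNReal.toReal_mono (ENNReal.pow_ne_top (ne_top_of_le_ne_top ENNReal.one_ne_top
    tsub_le_self)) h0
  rw [ENNReal.toReal_mul, ENNReal.toReal_prod, ENNReal.toReal_pow,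
    hr _ (hitProb_le_one hsub hν x)] at h1
  simp only [hr _ (qh_le_one hsub x _)] at h1
  set N := (Qit K ν t (fun B => if x ∈ B then 0 else 1) ∅).toReal with hN
  have hN0 : 0 ≤ N := ENNReal.toReal_nonneg
  have hq1 : ∀ y, (qh K x y).toReal ≤ 1 := fun y => by
    simpa using ENNReal.toReal_mono ENNReal.one_ne_top (qh_le_one hsub x y)
  have hp1 : (hitProb K ν x).toReal ≤ 1 := by
    simpa using ENNReal.toReal_mono ENNReal.one_ne_top (hitProb_le_one hsub hν x)
  have hp0 : 0 ≤ (hitProb K ν x).toReal := ENNReal.toReal_nonneg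
  have h2 : Real.exp (-(c / (1 - c) * ∑ y, (qh K x y).toReal))
      ≤ ∏ y, (1 - c * (qh K x y).toReal) := by
    rw [Finset.mul_sum, ← Finset.sum_neg_distrib, Real.exp_sum]
    exact Finset.prod_le_prod (fun y _ => (Real.exp_pos _).le)
      fun y _ => factor_bound hc0 hc1 ENNReal.toReal_nonneg (hq1 y)
  have h3 : (1 - c * (hitProb K ν x).toReal) ^ t
      ≤ Real.exp (-(c * (hitProb K ν x).toReal * t)) := by
    have : Real.exp (-(c * (hitProb K ν x).toReal * t))
        = Real.exp (-(c * (hitProb K ν x).toReal)) ^ t := by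
      rw [← Real.exp_nat_mul]; congr 1; ring
    rw [this]
    have hcp : c * (hitProb K ν x).toReal ≤ 1 := by nlinarith
    exact pow_le_pow_left₀ (by linarith) (Real.one_sub_le_exp_neg _) t
  have h4 : Real.exp (-(c / (1 - c) * ∑ y, (qh K x y).toReal)) * N
      ≤ Real.exp (-(c * (hitProb K ν x).toReal * t)) :=
    (mul_le_mul_of_nonneg_right h2 hN0).trans (h1.trans h3)
  rw [Real.exp_add]
  rw [Real.exp_neg, inv_mul_le_iff₀ (Real.exp_pos _)] at h4
  linarith

theorem Rt_real_le (hsub : SubStochastic K) (hnd : NonDegenerate K) {ν : V → ℝ≥0∞}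
    (hν : IsProbVec ν) (t : ℕ) :
    (Rt K ν t).toReal ≤ ∑ x, (Qit K ν t (fun B => if x ∈ B then 0 else 1) ∅).toReal := by
  have hT : ∀ x ∈ (Finset.univ : Finset V),
      Qit K ν t (fun B => if x ∈ B then 0 else 1) ∅ ≠ ⊤ := fun x _ =>
    Qit_ne_top hsub hnd hν t (fun B => by split_ifs <;> simp) _
  rw [← ENNReal.toReal_sum hT]
  exact ENNReal.toReal_mono (ENNReal.sum_ne_top.2 hT) (Rt_le_sum ν t)

theorem Rt_tendsto (hsub : SubStochastic K) (hnd : NonDegenerate K) {ν : V → ℝ≥0∞}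
    (hν : IsProbVec ν) (hadm : Admissible K ν) :
    Tendsto (fun t => (Rt K ν t).toReal) atTop (nhds 0) := by
  refine squeeze_zero (fun _ => ENNReal.toReal_nonneg) (Rt_real_le hsub hnd hν) ?_
  rw [show (0:ℝ) = ∑ x : V, (0:ℝ) by simp]
  refine tendsto_finsetSum _ fun x _ => ?_
  refine squeeze_zero (fun _ => ENNReal.toReal_nonneg)
    (fun t => tail_real hsub hnd hν (c := 1/2) (by norm_num) (by norm_num) x t) ?_
  have hp : 0 < (hitProb K ν x).toReal := ENNReal.toReal_pos (hadm x).ne'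
    (ne_top_of_le_ne_top ENNReal.one_ne_top (hitProb_le_one hsub hν x))
  refine Real.tendsto_exp_atBot.comp ?_
  refine tendsto_atBot_add_const_right _ _ ?_
  refine tendsto_neg_atTop_atBot.comp ?_
  exact tendsto_natCast_atTop_atTop.const_mul_atTop (by positivity)

theorem stat_le_mu (hsub : SubStochastic K) (hnd : NonDegenerate K) (lam : ℝ) {ν : V → ℝ≥0∞}
    (hν : IsProbVec ν) (hadm : Admissible K ν)
    {π : (V → Bool) → ℝ} (hπ : IsStationary (arwMatrix K lam ν) π) (ξ : V → Bool) :
    π ξ ≤ (mu K (ENNReal.ofReal lam) ξ).toReal := by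
  have h := (Rt_tendsto hsub hnd hν hadm).const_add (mu K (ENNReal.ofReal lam) ξ).toReal
  rw [add_zero] at h
  exact ge_of_tendsto' h fun t => stat_le hsub hnd lam hν hπ t ξ

theorem sepMix_le (hsub : SubStochastic K) (hnd : NonDegenerate K) (lam : ℝ) {ν : V → ℝ≥0∞}
    (hν : IsProbVec ν) (hadm : Admissible K ν)
    {π : (V → Bool) → ℝ} (hπ : IsStationary (arwMatrix K lam ν) π) (t : ℕ)
    (ht : (Rt K ν t).toReal ≤ 1 / 2) :
    sepMix (arwMatrix K lam ν) π (1 / 2) ≤ t := by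
  by_cases hpos : ∀ ξ, 0 < π ξ
  · refine Nat.sInf_le ?_
    change sepDist _ _ t ≤ 1 / 2
    unfold sepDist
    refine ciSup_le fun η => ?_
    refine ciSup_le fun ξ => ?_
    have h1 := real_lower hsub hnd lam hν t η ξ
    have h2 := stat_le_mu hsub hnd lam hν hadm hπ ξ
    have h3 : 1 / 2 ≤ (arwMatrix K lam ν ^ t) η ξ / π ξ := by
      rw [le_div_iff₀ (hpos ξ)]
      have := hpos ξ
      nlinarith
    linarith
  · push Not at hpos
    obtain ⟨ξ, hξ⟩ := hpos
    have h0 : π ξ = 0 := le_antisymm hξ (hπ.1 ξ)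
    have : {t : ℕ | sepDist (arwMatrix K lam ν) π t ≤ 1 / 2} = ∅ := by
      rw [Set.eq_empty_iff_forall_notMem]
      intro s hs
      have hs' : sepDist (arwMatrix K lam ν) π s ≤ 1 / 2 := hs
      have h1 : (1 - (arwMatrix K lam ν ^ s) ξ ξ / π ξ) ≤ sepDist (arwMatrix K lam ν) π s := by
        unfold sepDist
        refine le_trans ?_ (le_ciSup (Set.finite_range _).bddAbove ξ)
        exact le_ciSup (f := fun ξ' => 1 - (arwMatrix K lam ν ^ s) ξ ξ' / π ξ')
          (Set.finite_range _).bddAbove ξ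
      rw [h0, div_zero] at h1
      linarith
    unfold sepMix
    rw [this]
    simp

theorem num_bound {n p m R T : ℝ} {t : ℕ} (hn : 2 ≤ n) (hp : 0 < p) (hp1 : p ≤ 1) (hm : 0 < m)
    (hmR : m ≤ R * p) (hT : 1 ≤ T * p) (hT0 : 0 ≤ T)
    (ht : (Real.sqrt R + 3 * Real.sqrt (T * Real.log n)) ^ 2 ≤ (t : ℝ) + 1) :
    ∃ c : ℝ, 0 ≤ c ∧ c < 1 ∧
      Real.exp (-(c * p * t) + c / (1 - c) * m) ≤ 1 / (2 * n) := by
  have hlog : 0.69 ≤ Real.log n := by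
    have h2 := Real.log_two_gt_d9
    have := Real.log_le_log (by norm_num) hn
    linarith
  set L := Real.log n with hL
  have hR : 0 ≤ R := by
    by_contra h
    rw [not_le] at h
    nlinarith
  set a := p * ((t : ℝ) + 1) with ha
  have hapos : 0 < a := by positivity
  have h1 : Real.sqrt m + 3 * Real.sqrt L ≤ Real.sqrt a := by
    have e1 : Real.sqrt a = Real.sqrt p * Real.sqrt ((t:ℝ) + 1) := Real.sqrt_mul hp.le _
    have e2 : Real.sqrt R + 3 * Real.sqrt (T * L) ≤ Real.sqrt ((t:ℝ) + 1) :=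
      Real.le_sqrt_of_sq_le ht
    have e3 : Real.sqrt m ≤ Real.sqrt p * Real.sqrt R := by
      rw [← Real.sqrt_mul hp.le]
      exact Real.sqrt_le_sqrt (by linarith)
    have e4 : Real.sqrt L ≤ Real.sqrt p * Real.sqrt (T * L) := by
      rw [← Real.sqrt_mul hp.le]
      exact Real.sqrt_le_sqrt (by nlinarith)
    rw [e1]
    have := mul_le_mul_of_nonneg_left e2 (Real.sqrt_nonneg p)
    linarith
  set A := Real.sqrt a with hA
  set M := Real.sqrt m with hM
  have hAA : A * A = a := Real.mul_self_sqrt hapos.le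
  have hMM : M * M = m := Real.mul_self_sqrt hm.le
  have hMpos : 0 < M := Real.sqrt_pos.2 hm
  have hLpos : 0 < Real.sqrt L := Real.sqrt_pos.2 (by linarith)
  have hLL : Real.sqrt L * Real.sqrt L = L := Real.mul_self_sqrt (by linarith)
  have hMA : M < A := by linarith
  have hApos : 0 < A := by linarith
  have hc1 : M / A < 1 := (div_lt_one hApos).2 hMA
  have hc0 : 0 < M / A := by positivity
  refine ⟨1 - M / A, by linarith, by linarith, ?_⟩
  have e5 : -((1 - M / A) * p * t) + (1 - M / A) / (1 - (1 - M / A)) * m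
      = -(A - M) ^ 2 + (1 - M / A) * p := by
    have ept : p * t = A * A - p := by rw [hAA, ha]; ring
    have : (1 - M / A) * p * t = (1 - M / A) * (A * A - p) := by rw [← ept]; ring
    rw [this, ← hMM, sub_sub_cancel]
    field_simp
    ring
  have e6 : 9 * L ≤ (A - M) ^ 2 := by nlinarith
  have e7 : (1 - M / A) * p ≤ 1 := by nlinarith
  rw [e5, one_div, ← Real.exp_log (show (0:ℝ) < (2 * n)⁻¹ by positivity)]
  apply Real.exp_le_exp.2
  rw [Real.log_inv, Real.log_mul (by norm_num) (by linarith)]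
  have := Real.log_two_lt_d9
  linarith

end link

/-- **Lemma (A general upper bound on the separation mixing time).**
`t_sep ≤ (√𝓡 + 3 √(t_rel log n))²`, where `n = |V|`,
`𝓡 = n max_x P_𝒰(τ_x<τ_†)/p(x)` and `t_rel = (min_x p(x))⁻¹`. -/
theorem arw_sepMix_upper_bound
    {V : Type} [Fintype V] [DecidableEq V] [Nonempty V]
    (K : V → V → ℝ≥0∞) (hsub : SubStochastic K) (hnd : NonDegenerate K)
    (ν : V → ℝ≥0∞) (hν : IsProbVec ν) (hadm : Admissible K ν)
    (lam : ℝ) (hlam : 0 < lam)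
    (π : (V → Bool) → ℝ) (hπ : IsStationary (arwMatrix K lam ν) π) :
    (sepMix (arwMatrix K lam ν) π (1 / 2) : ℝ)
      ≤ (Real.sqrt ((Fintype.card V : ℝ)
            * ⨆ x, (hitProb K (unifLaw V) x).toReal / (hitProb K ν x).toReal)
          + 3 * Real.sqrt (((⨅ x, hitProb K ν x).toReal)⁻¹
              * Real.log (Fintype.card V))) ^ 2 := by
  have hpT : ∀ x, hitProb K ν x ≠ ⊤ := fun x =>
    ne_top_of_le_ne_top ENNReal.one_ne_top (hitProb_le_one hsub hν x)
  have hp : ∀ x, 0 < (hitProb K ν x).toReal := fun x => ENNReal.toReal_pos (hadm x).ne' (hpT x)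
  have hp1 : ∀ x, (hitProb K ν x).toReal ≤ 1 := fun x => by
    simpa using ENNReal.toReal_mono ENNReal.one_ne_top (hitProb_le_one hsub hν x)
  have hcard : 1 ≤ Fintype.card V := Fintype.card_pos
  rcases Nat.eq_or_lt_of_le hcard with h1 | h2
  · -- one site
    obtain ⟨x, hx⟩ := Fintype.card_eq_one_iff.1 h1.symm
    have hall : (Finset.univ : Finset V) = {x} := by
      ext y; simp [hx y]
    have hνx : ν = unifLaw V := by
      funext y
      have := hν
      rw [IsProbVec, hall, Finset.sum_singleton] at this
      rw [hx y, this, unifLaw, ← h1]; simp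
    have hR : sepMix (arwMatrix K lam ν) π (1 / 2) ≤ 1 := by
      refine sepMix_le hsub hnd lam hν hadm hπ 1 ?_
      have : Rt K ν 1 = 0 := by
        unfold Rt
        simp only [Qit]
        rw [Qop_eq]
        refine Finset.sum_eq_zero fun y _ => ?_
        rw [uf_off hsub hnd _ (Finset.notMem_empty y), if_pos, mul_zero]
        rw [hx y, hall]; rfl
      rw [this]; simp
    have hS : (⨆ x, (hitProb K (unifLaw V) x).toReal / (hitProb K ν x).toReal) = 1 := by
      rw [← hνx]
      have : ∀ x, (hitProb K ν x).toReal / (hitProb K ν x).toReal = 1 :=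
        fun x => div_self (hp x).ne'
      simp [this]
    rw [hS, ← h1]
    simpa using hR
  · set n : ℝ := (Fintype.card V : ℝ) with hn0
    have hn : 2 ≤ n := by rw [hn0]; exact_mod_cast h2
    set s := ⨆ x, (hitProb K (unifLaw V) x).toReal / (hitProb K ν x).toReal with hs
    set T := ((⨅ x, hitProb K ν x).toReal)⁻¹ with hT
    set Bd := (Real.sqrt (n * s) + 3 * Real.sqrt (T * Real.log n)) ^ 2 with hBd
    have hBd0 : 0 ≤ Bd := sq_nonneg _
    refine le_trans (Nat.cast_le.2 (sepMix_le hsub hnd lam hν hadm hπ ⌊Bd⌋₊ ?_))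
      (Nat.floor_le hBd0)
    have hT0 : 0 ≤ T := inv_nonneg.2 ENNReal.toReal_nonneg
    have hTp : ∀ x, 1 ≤ T * (hitProb K ν x).toReal := by
      intro x
      obtain ⟨x0, hx0⟩ := Finite.exists_min (fun x => hitProb K ν x)
      have e : (⨅ x, hitProb K ν x) = hitProb K ν x0 :=
        le_antisymm (iInf_le _ x0) (le_iInf hx0)
      rw [hT, e, inv_mul_eq_div, le_div_iff₀ (hp x0), one_mul]
      exact ENNReal.toReal_mono (hpT x) (hx0 x)
    have hqT : ∀ x y, qh K x y ≠ ⊤ := fun x y =>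
      ne_top_of_le_ne_top ENNReal.one_ne_top (qh_le_one hsub x y)
    have hm : ∀ x, ∑ y, (qh K x y).toReal = n * (hitProb K (unifLaw V) x).toReal := by
      intro x
      rw [hitProb_eq]
      simp only [unifLaw]
      rw [← Finset.mul_sum, ENNReal.toReal_mul, ENNReal.toReal_sum fun y _ => hqT x y,
        ENNReal.toReal_inv, ENNReal.toReal_natCast, ← mul_assoc, mul_inv_cancel₀ (by positivity),
        one_mul]
    have hmpos : ∀ x, 0 < ∑ y, (qh K x y).toReal := by
      intro x
      refine (hp x).trans_le ?_
      rw [← ENNReal.toReal_sum fun y _ => hqT x y, hitProb_eq]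
      refine ENNReal.toReal_mono (ENNReal.sum_ne_top.2 fun y _ => hqT x y) ?_
      refine Finset.sum_le_sum fun y _ => mul_le_of_le_one_left' ?_
      rw [← hν]
      exact Finset.single_le_sum (fun _ _ => zero_le) (Finset.mem_univ y)
    have hmR : ∀ x, ∑ y, (qh K x y).toReal ≤ n * s * (hitProb K ν x).toReal := by
      intro x
      rw [hm, mul_assoc]
      refine mul_le_mul_of_nonneg_left ?_ (by linarith)
      rw [← div_le_iff₀ (hp x)]
      exact le_ciSup (f := fun x => (hitProb K (unifLaw V) x).toReal / (hitProb K ν x).toReal)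
        (Set.finite_range _).bddAbove x
    refine (Rt_real_le hsub hnd hν _).trans ?_
    calc _ ≤ ∑ x : V, 1 / (2 * n) := by
          refine Finset.sum_le_sum fun x _ => ?_
          obtain ⟨c, hc0, hc1, hc⟩ := num_bound (t := ⌊Bd⌋₊) hn (hp x) (hp1 x) (hmpos x) (hmR x)
            (hTp x) hT0 (Nat.lt_floor_add_one Bd).le
          exact (tail_real hsub hnd hν hc0 hc1 x _).trans hc
      _ = 1 / 2 := by
          rw [Finset.sum_const, Finset.card_univ, nsmul_eq_mul, ← hn0]
          field_simp

end ARW
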